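/- Let 0 < λ < π/κ. Then there exist constants 0 < c ≤ C < ∞, depending only on λ and κ, such that for all t > 0 and all x, y ∈ 𝒟: c · w_{1,λ}(x) w_{1,λ}(y) / √( w_{2,2λ}(B(x, √t)) · w_{2,2λ}(B(y, √t)) ) ≤ R_{t,x}^{λ−1} R_{t,y}^{λ−1} J_{t,x} J_{t,y} / t ≤ C · w_{1,λ}(x) w_{1,λ}(y) / √( w_{2,2λ}(B(x, √t)) · w_{2,2λ}(B(y, √t)) ), where w_{1,λ}(x) = |x|^{λ−1} ρ_𝒟(x). -/

import Mathlib

open MeasureTheory Set Real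
open scoped ENNReal

noncomputable section

abbrev E2 := EuclideanSpace ℝ (Fin 2)

/-- The planar angular domain with opening angle `κ`. -/
def Dset (κ : ℝ) : Set E2 :=
  {x | ∃ r φ : ℝ, 0 < r ∧ 0 < φ ∧ φ < κ ∧ x 0 = r * Real.cos φ ∧ x 1 = r * Real.sin φ}

/-- `B(x, r)`: the part of the Euclidean ball of radius `r` around `x` lying in `𝒟`. -/
def ballD (κ : ℝ) (x : E2) (r : ℝ) : Set E2 :=
  {y | y ∈ Dset κ ∧ dist y x < r}

/-- Geodesic (arc-length) distance between unit vectors of `S¹ ⊆ ℝ²`. -/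
def dS1 (u v : E2) : ℝ := Real.arccos (inner ℝ u v)

/-- The "windshield wiper" set `S(x, r)`; for `x = 0` the angular condition is vacuous
(convention `a/0 = ∞`). -/
def Sset (κ : ℝ) (x : E2) (r : ℝ) : Set E2 :=
  {y | y ∈ Dset κ ∧ |‖y‖ - ‖x‖| < r ∧ (x ≠ 0 → dS1 (‖x‖⁻¹ • x) (‖y‖⁻¹ • y) < r / ‖x‖)}

/-- Distance from `x` to the boundary of `𝒟`. -/
def rhoD (κ : ℝ) (x : E2) : ℝ := Metric.infDist x (frontier (Dset κ))

/-- The mixed power weight `w_{γ,ν}(x) = ρ_∘(x)^{ν-γ} ρ_𝒟(x)^γ`. -/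
def wgt (κ γ ν : ℝ) (x : E2) : ℝ := ‖x‖ ^ (ν - γ) * rhoD κ x ^ γ

/-- `w_{γ,ν}(E) = ∫_E w_{γ,ν} dx`, valued in `[0,∞]`. -/
def wMeas (κ γ ν : ℝ) (E : Set E2) : ℝ≥0∞ :=
  ∫⁻ x in E, ENNReal.ofReal (wgt κ γ ν x)

/-- The open planar sector of points with polar angle in `(a, b)`. -/
def sector (a b : ℝ) : Set E2 :=
  {x | ∃ r φ : ℝ, 0 < r ∧ a < φ ∧ φ < b ∧ x 0 = r * Real.cos φ ∧ x 1 = r * Real.sin φ}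

/-- A vector whose component orthogonal to the direction `m` is at most `tan δ` times its positive
component along `m` has a polar angle within `δ` of `m`. -/
lemma exists_polar_near {u v m δ : ℝ} (hδ0 : 0 ≤ δ) (hδ : δ < π / 2)
    (hp : 0 < u * cos m + v * sin m)
    (hq : |v * cos m - u * sin m| ≤ (u * cos m + v * sin m) * tan δ) :
    ∃ r θ : ℝ, 0 < r ∧ |θ| ≤ δ ∧ u = r * cos (m + θ) ∧ v = r * sin (m + θ) := by
  set p := u * cos m + v * sin m with hp_def
  set q := v * cos m - u * sin m with hq_def
  have hcos : 0 < cos (arctan (q / p)) := cos_arctan_pos _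
  have hqp : |q / p| ≤ tan δ := by
    rw [abs_div, abs_of_pos hp, div_le_iff₀ hp]; linarith
  have hdel : arctan (tan δ) = δ := arctan_tan (by linarith) hδ
  have hsin : sin (arctan (q / p)) = q / p * cos (arctan (q / p)) := by
    have h := tan_mul_cos hcos.ne'
    rw [tan_arctan] at h
    exact h.symm
  refine ⟨p / cos (arctan (q / p)), arctan (q / p), by positivity, ?_, ?_, ?_⟩
  · rw [abs_le] at hqp ⊢
    constructor
    · rw [← hdel, ← arctan_neg]
      exact arctan_strictMono.monotone hqp.1
    · rw [← hdel]
      exact arctan_strictMono.monotone hqp.2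
  · rw [cos_add, hsin]
    field_simp
    rw [hp_def, hq_def]
    linear_combination (-u) * sin_sq_add_cos_sq m
  · rw [sin_add, hsin]
    field_simp
    rw [hp_def, hq_def]
    linear_combination (-v) * sin_sq_add_cos_sq m

/-- The sum of two vectors whose polar angles differ by less than `π` has a polar angle in between,
so it lies in every sector containing both angles. -/
lemma add_mem_sector {a b r φ s ψ : ℝ} {x y : E2} (hr : 0 < r) (hs : 0 < s)
    (haφ : a < φ) (hφb : φ < b) (haψ : a < ψ) (hψb : ψ < b) (h : |ψ - φ| < π)
    (hx0 : x 0 = r * cos φ) (hx1 : x 1 = r * sin φ)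
    (hy0 : y 0 = s * cos ψ) (hy1 : y 1 = s * sin ψ) : x + y ∈ sector a b := by
  obtain ⟨m, hm⟩ : ∃ m, m = (φ + ψ) / 2 := ⟨_, rfl⟩
  obtain ⟨d, hd⟩ : ∃ d, d = (ψ - φ) / 2 := ⟨_, rfl⟩
  have hφ : φ = m - d := by linarith
  have hψ : ψ = m + d := by linarith
  have hdabs : |d| < π / 2 := by
    rw [hd, abs_div, abs_two]; linarith
  have hcosd : 0 < cos d := by
    rw [abs_lt] at hdabs
    exact cos_pos_of_mem_Ioo ⟨by linarith, hdabs.2⟩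
  have hm2 := sin_sq_add_cos_sq m
  have hp : (x + y) 0 * cos m + (x + y) 1 * sin m = (r + s) * cos d := by
    simp only [PiLp.add_apply, hx0, hx1, hy0, hy1, hφ, hψ, cos_add, cos_sub, sin_add, sin_sub]
    linear_combination ((r + s) * cos d) * hm2
  have hq : (x + y) 1 * cos m - (x + y) 0 * sin m = (s - r) * sin d := by
    simp only [PiLp.add_apply, hx0, hx1, hy0, hy1, hφ, hψ, cos_add, cos_sub, sin_add, sin_sub]
    linear_combination ((s - r) * sin d) * hm2
  have htan : cos d * tan |d| = |sin d| := by
    rw [← cos_abs d, mul_comm, tan_mul_cos (by rw [cos_abs]; exact hcosd.ne')]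
    have h0 : 0 ≤ sin |d| :=
      sin_nonneg_of_nonneg_of_le_pi (abs_nonneg _) (by linarith [pi_pos])
    rcases abs_cases d with ⟨h1, _⟩ | ⟨h1, _⟩
    · rw [h1] at h0 ⊢; rw [abs_of_nonneg h0]
    · rw [h1, sin_neg] at h0 ⊢; rw [abs_of_nonpos (by linarith)]
  obtain ⟨ρ, θ, hρ, hθ, h0, h1⟩ :=
    exists_polar_near (u := (x + y) 0) (v := (x + y) 1) (m := m) (abs_nonneg d) hdabs
      (by rw [hp]; positivity)
      (by
        rw [hp, hq, mul_assoc, htan, abs_mul]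
        refine mul_le_mul_of_nonneg_right ?_ (abs_nonneg _)
        rw [abs_le]; constructor <;> linarith)
  refine ⟨ρ, m + θ, hρ, ?_, ?_, h0, h1⟩ <;> rw [abs_le] at hθ <;>
    rcases abs_cases d with ⟨h1, _⟩ | ⟨h1, _⟩ <;> linarith

/-- Every nonempty sector of opening less than `π` contains a ball around a unit vector. -/
lemma exists_ball_subset_sector {a b : ℝ} (hab : a < b) (hba : b - a < π) :
    ∃ v : E2, ‖v‖ = 1 ∧ ∃ δ : ℝ, 0 < δ ∧ Metric.ball v δ ⊆ sector a b := by
  set m := (a + b) / 2 with hm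
  set η := (b - a) / 4 with hη
  have hη0 : 0 < η := by linarith
  have hη1 : η < π / 2 := by linarith
  have hm2 := sin_sq_add_cos_sq m
  let v : E2 := !₂[cos m, sin m]
  have hopen : IsOpen {x : E2 | |x 1 * cos m - x 0 * sin m| <
      (x 0 * cos m + x 1 * sin m) * tan η} :=
    isOpen_lt (by fun_prop) (by fun_prop)
  have htan : 0 < tan η := tan_pos_of_pos_of_lt_pi_div_two hη0 hη1
  have hv : v ∈ {x : E2 | |x 1 * cos m - x 0 * sin m| <
      (x 0 * cos m + x 1 * sin m) * tan η} := by
    have h1 : sin m * cos m - cos m * sin m = 0 := by ring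
    have h2 : cos m * cos m + sin m * sin m = 1 := by linarith
    simp [v, h1, h2, htan]
  obtain ⟨δ, hδ, hsub⟩ := Metric.isOpen_iff.mp hopen v hv
  refine ⟨v, ?_, δ, hδ, fun x hx => ?_⟩
  · simp [v, EuclideanSpace.norm_eq, Fin.sum_univ_two]
  · have hx' := hsub hx
    simp only [mem_ofPred_eq] at hx'
    have hp : 0 < x 0 * cos m + x 1 * sin m :=
      pos_of_mul_pos_left ((abs_nonneg _).trans_lt hx') htan.le
    obtain ⟨r, θ, hr, hθ, h0, h1⟩ := exists_polar_near hη0.le hη1 hp hx'.le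
    rw [abs_le] at hθ
    exact ⟨r, m + θ, hr, by linarith, by linarith, h0, h1⟩

lemma norm_pos_of_mem_Dset {κ : ℝ} {x : E2} (hx : x ∈ Dset κ) : 0 < ‖x‖ := by
  obtain ⟨r, φ, hr, -, -, h0, h1⟩ := hx
  rw [norm_pos_iff]
  rintro rfl
  have h0' : r * cos φ = 0 := by simpa using h0.symm
  have h1' : r * sin φ = 0 := by simpa using h1.symm
  have hc : cos φ = 0 := (mul_eq_zero.mp h0').resolve_left hr.ne'
  have hs : sin φ = 0 := (mul_eq_zero.mp h1').resolve_left hr.ne'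
  simpa [hc, hs] using sin_sq_add_cos_sq φ

lemma smul_mem_sector {a b c : ℝ} (hc : 0 < c) {x : E2} (hx : x ∈ sector a b) :
    c • x ∈ sector a b := by
  obtain ⟨r, φ, hr, ha, hb, h0, h1⟩ := hx
  exact ⟨c * r, φ, by positivity, ha, hb, by simp [h0, mul_assoc], by simp [h1, mul_assoc]⟩

/-- Points of `𝒟` admit a translated half-sector inside `𝒟`, which contains balls of size
proportional to the distance from the vertex. -/
lemma exists_corkscrew {κ : ℝ} (hκ : 0 < κ) (hκ' : κ < 2 * π) :
    ∃ δ : ℝ, 0 < δ ∧ ∀ x ∈ Dset κ, ∀ a : ℝ, 0 < a →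
      ∃ z : E2, dist z x = a ∧ Metric.ball z (a * δ) ⊆ Dset κ := by
  obtain ⟨v, hv, δ, hδ, hsub⟩ :=
    exists_ball_subset_sector (a := 0) (b := κ / 2) (by linarith) (by linarith)
  obtain ⟨v', hv', δ', hδ', hsub'⟩ :=
    exists_ball_subset_sector (a := κ / 2) (b := κ) (by linarith) (by linarith)
  have main : ∀ (a : ℝ), 0 < a → ∀ (x u : E2) (ε : ℝ), ‖u‖ = 1 → min δ δ' ≤ ε →
      (∀ y ∈ Metric.ball u ε, x + a • y ∈ Dset κ) →
      ∃ z : E2, dist z x = a ∧ Metric.ball z (a * min δ δ') ⊆ Dset κ := by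
    intro a ha x u ε hu hε h
    refine ⟨x + a • u, by simp [dist_eq_norm, norm_smul, hu, abs_of_pos ha], fun y hy => ?_⟩
    have hy2 : x + a • (a⁻¹ • (y - x)) = y := by
      rw [smul_smul, mul_inv_cancel₀ ha.ne', one_smul]; abel
    rw [← hy2]
    apply h
    have h3 : y - (x + a • u) = a • (a⁻¹ • (y - x) - u) := by
      rw [smul_sub, smul_smul, mul_inv_cancel₀ ha.ne', one_smul]; abel
    rw [Metric.mem_ball, dist_eq_norm] at hy ⊢
    rw [h3, norm_smul, Real.norm_eq_abs, abs_of_pos ha] at hy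
    exact (lt_of_mul_lt_mul_left hy ha.le).trans_le hε
  refine ⟨min δ δ', lt_min hδ hδ', fun x hx a ha => ?_⟩
  obtain ⟨r, φ, hr, hφ0, hφκ, h0, h1⟩ := hx
  rcases le_total φ (κ / 2) with hφ | hφ
  · refine main a ha x v δ hv (min_le_left _ _) fun y hy => ?_
    obtain ⟨s, ψ, hs, hψ0, hψ1, k0, k1⟩ := smul_mem_sector ha (hsub hy)
    exact add_mem_sector hr hs hφ0 hφκ hψ0 (by linarith)
      (abs_lt.mpr ⟨by linarith, by linarith⟩) h0 h1 k0 k1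
  · refine main a ha x v' δ' hv' (min_le_right _ _) fun y hy => ?_
    obtain ⟨s, ψ, hs, hψ0, hψ1, k0, k1⟩ := smul_mem_sector ha (hsub' hy)
    exact add_mem_sector hr hs hφ0 hφκ (by linarith) hψ1
      (abs_lt.mpr ⟨by linarith, by linarith⟩) h0 h1 k0 k1

lemma zero_mem_frontier_Dset {κ : ℝ} (hκ : 0 < κ) : (0 : E2) ∈ frontier (Dset κ) := by
  constructor
  · rw [Metric.mem_closure_iff]
    intro ε hε
    refine ⟨(ε / 2) • !₂[cos (κ / 2), sin (κ / 2)],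
      ⟨ε / 2, κ / 2, by linarith, by linarith, by linarith, by simp, by simp⟩, ?_⟩
    rw [dist_zero_left, norm_smul]
    simp [EuclideanSpace.norm_eq, Fin.sum_univ_two, abs_of_pos hε]
    linarith
  · intro h
    simpa using norm_pos_of_mem_Dset (interior_subset h)

lemma rhoD_nonneg (κ : ℝ) (x : E2) : 0 ≤ rhoD κ x := Metric.infDist_nonneg

lemma rhoD_le_norm {κ : ℝ} (hκ : 0 < κ) (x : E2) : rhoD κ x ≤ ‖x‖ := by
  simpa [rhoD] using Metric.infDist_le_dist_of_mem (x := x) (zero_mem_frontier_Dset hκ)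

lemma rhoD_le_rhoD_add_dist (κ : ℝ) (x y : E2) : rhoD κ x ≤ rhoD κ y + dist x y :=
  Metric.infDist_le_infDist_add_dist

lemma le_rhoD_of_ball_subset {κ : ℝ} (hκ : 0 < κ) {y : E2} {r : ℝ}
    (h : Metric.ball y r ⊆ Dset κ) : r ≤ rhoD κ y := by
  refine (Metric.le_infDist ⟨0, zero_mem_frontier_Dset hκ⟩).mpr fun z hz => ?_
  by_contra! hlt
  exact hz.2 (interior_maximal h Metric.isOpen_ball (by rwa [Metric.mem_ball, dist_comm]))

/-- Powers of comparable positive numbers are comparable. -/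
lemma rpow_comparable {n T L β : ℝ} (hn : 0 < n) (hnT : n ≤ T) (hTL : T ≤ L * n) :
    L ^ (-|β|) * T ^ β ≤ n ^ β ∧ n ^ β ≤ L ^ |β| * T ^ β := by
  have hT : 0 < T := hn.trans_le hnT
  have hL : 0 < L := pos_of_mul_pos_left (hT.trans_le hTL) hn.le
  have hL1 : 1 ≤ L := by
    by_contra! h
    nlinarith
  rcases le_total 0 β with hβ | hβ
  · rw [abs_of_nonneg hβ]
    constructor
    · rw [rpow_neg hL.le, inv_mul_le_iff₀ (by positivity), ← mul_rpow hL.le hn.le]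
      exact rpow_le_rpow hT.le hTL hβ
    · calc n ^ β ≤ 1 * T ^ β := by rw [one_mul]; exact rpow_le_rpow hn.le hnT hβ
        _ ≤ _ := by gcongr; exact one_le_rpow hL1 hβ
  · rw [abs_of_nonpos hβ, neg_neg]
    constructor
    · calc L ^ β * T ^ β ≤ 1 * T ^ β := by
            gcongr; exact rpow_le_one_of_one_le_of_nonpos hL1 hβ
        _ ≤ n ^ β := by rw [one_mul]; exact rpow_le_rpow_of_nonpos hn hnT hβ
    · rw [rpow_neg hL.le, le_inv_mul_iff₀ (by positivity), ← mul_rpow hL.le hn.le]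
      exact rpow_le_rpow_of_nonpos hT hTL hβ

/-- Pointwise upper bound for the weight on a ball of radius `s`. -/
lemma wgt_le {κ lam : ℝ} (hκ : 0 < κ) (hlam : 0 < lam) {x y : E2} {s : ℝ} (hs : 0 < s)
    (hy : y ∈ ballD κ x s) :
    wgt κ 2 (2 * lam) y ≤ (9 + 3 ^ |2 * lam - 2|) *
      ((‖x‖ + s) ^ (2 * lam - 2) * (rhoD κ x + s) ^ 2) := by
  obtain ⟨hyD, hyx⟩ := hy
  have hn := norm_pos_of_mem_Dset hyD
  have hp0 := rhoD_nonneg κ y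
  have hq0 := rhoD_nonneg κ x
  have hpn := rhoD_le_norm hκ y
  have hpq : rhoD κ y ≤ rhoD κ x + s := by linarith [rhoD_le_rhoD_add_dist κ y x]
  have hN0 := norm_nonneg x
  rw [dist_eq_norm] at hyx
  have hnN : ‖y‖ ≤ ‖x‖ + s := by linarith [norm_sub_norm_le y x]
  have hNn : ‖x‖ ≤ ‖y‖ + s := by linarith [norm_sub_norm_le x y, norm_sub_rev x y]
  rw [wgt, rpow_two, add_mul]
  have hT : 0 < ‖x‖ + s := by linarith
  have hTβ : 0 < (‖x‖ + s) ^ (2 * lam - 2) := rpow_pos_of_pos hT _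
  have h3 : (0:ℝ) < 3 ^ |2 * lam - 2| := by positivity
  rcases le_or_gt (‖x‖ + s) (3 * ‖y‖) with h | h
  · have h1 := (rpow_comparable (β := 2 * lam - 2) hn hnN h).2
    calc ‖y‖ ^ (2 * lam - 2) * rhoD κ y ^ 2
        ≤ (3 ^ |2 * lam - 2| * (‖x‖ + s) ^ (2 * lam - 2)) * (rhoD κ x + s) ^ 2 := by gcongr
      _ ≤ _ := by
        have : 0 ≤ 9 * ((‖x‖ + s) ^ (2 * lam - 2) * (rhoD κ x + s) ^ 2) := by positivity
        linarith
  · have hsplit : ∀ a : ℝ, 0 < a → a ^ (2 * lam - 2) * a ^ 2 = a ^ (2 * lam) := by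
      intro a ha
      rw [← rpow_two, ← rpow_add ha]; congr 1; ring
    calc ‖y‖ ^ (2 * lam - 2) * rhoD κ y ^ 2
        ≤ ‖y‖ ^ (2 * lam - 2) * ‖y‖ ^ 2 := by gcongr
      _ = ‖y‖ ^ (2 * lam) := hsplit _ hn
      _ ≤ (‖x‖ + s) ^ (2 * lam) := by gcongr
      _ = (‖x‖ + s) ^ (2 * lam - 2) * (‖x‖ + s) ^ 2 := (hsplit _ hT).symm
      _ ≤ (‖x‖ + s) ^ (2 * lam - 2) * (3 * (rhoD κ x + s)) ^ 2 := by
          gcongr; linarith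
      _ ≤ _ := by
        have : 0 ≤ 3 ^ |2 * lam - 2| * ((‖x‖ + s) ^ (2 * lam - 2) * (rhoD κ x + s) ^ 2) := by
          positivity
        linarith

/-- Pointwise lower bound for the weight at points away from the boundary. -/
lemma le_wgt {κ lam : ℝ} (hκ : 0 < κ) {x y : E2} {s c : ℝ} (hs : 0 < s) (hc : 0 < c)
    (hy : y ∈ ballD κ x s) (hcy : c * (rhoD κ x + s) ≤ rhoD κ y) :
    (1 + 2 / c) ^ (-|2 * lam - 2|) * c ^ 2 *
      ((‖x‖ + s) ^ (2 * lam - 2) * (rhoD κ x + s) ^ 2) ≤ wgt κ 2 (2 * lam) y := by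
  obtain ⟨hyD, hyx⟩ := hy
  have hn := norm_pos_of_mem_Dset hyD
  have hq0 := rhoD_nonneg κ x
  have hpn := rhoD_le_norm hκ y
  have hN0 := norm_nonneg x
  rw [dist_eq_norm] at hyx
  have hnN : ‖y‖ ≤ ‖x‖ + s := by linarith [norm_sub_norm_le y x]
  have hNn : ‖x‖ ≤ ‖y‖ + s := by linarith [norm_sub_norm_le x y, norm_sub_rev x y]
  have hsn : s ≤ ‖y‖ / c := by
    rw [le_div_iff₀ hc]; nlinarith
  have hT : ‖x‖ + s ≤ (1 + 2 / c) * ‖y‖ := by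
    have : (1 + 2 / c) * ‖y‖ = ‖y‖ + 2 * (‖y‖ / c) := by ring
    linarith
  have h1 := (rpow_comparable (β := 2 * lam - 2) hn hnN hT).1
  rw [wgt, rpow_two]
  calc _ = ((1 + 2 / c) ^ (-|2 * lam - 2|) * (‖x‖ + s) ^ (2 * lam - 2)) *
        (c * (rhoD κ x + s)) ^ 2 := by ring
    _ ≤ _ := by gcongr

/-- Two-sided estimate of the weighted volume of balls in `𝒟`. -/
lemma wMeas_ballD_comparable {κ lam : ℝ} (hκ : 0 < κ) (hκ' : κ < 2 * π) (hlam : 0 < lam) :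
    ∃ A B : ℝ, 0 < A ∧ 0 < B ∧ ∀ s : ℝ, 0 < s → ∀ x ∈ Dset κ,
      A * (s * (‖x‖ + s) ^ (lam - 1) * (rhoD κ x + s)) ^ 2 ≤
        (wMeas κ 2 (2 * lam) (ballD κ x s)).toReal ∧
      (wMeas κ 2 (2 * lam) (ballD κ x s)).toReal ≤
        B * (s * (‖x‖ + s) ^ (lam - 1) * (rhoD κ x + s)) ^ 2 := by
  obtain ⟨δ₀, hδ₀, hcork₀⟩ := exists_corkscrew hκ hκ'
  obtain ⟨δ, hδ, hδ1, hcork⟩ : ∃ δ : ℝ, 0 < δ ∧ δ ≤ 1 ∧ ∀ x ∈ Dset κ, ∀ a : ℝ, 0 < a →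
      ∃ z : E2, dist z x = a ∧ Metric.ball z (a * δ) ⊆ Dset κ := by
    refine ⟨min δ₀ 1, lt_min hδ₀ one_pos, min_le_right _ _, fun x hx a ha => ?_⟩
    obtain ⟨z, hz, hsub⟩ := hcork₀ x hx a ha
    exact ⟨z, hz, (Metric.ball_subset_ball (by gcongr; exact min_le_left _ _)).trans hsub⟩
  set c := δ / 16 with hc_def
  have hc : 0 < c := by positivity
  set K := (1 + 2 / c) ^ (-|2 * lam - 2|) * c ^ 2 with hK
  have hK0 : 0 < K := by positivity
  set K' : ℝ := 9 + 3 ^ |2 * lam - 2| with hK'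
  have hK'0 : 0 < K' := by positivity
  have hball : ∀ (z : E2) (k r : ℝ), 0 ≤ k → 0 ≤ r →
      ENNReal.ofReal k * volume (Metric.ball z r) = ENNReal.ofReal (k * (r ^ 2 * π)) := by
    intro z k r hk hr
    rw [EuclideanSpace.volume_ball_fin_two, ENNReal.ofReal_mul hk,
      ENNReal.ofReal_mul (by positivity), ENNReal.ofReal_pow hr,
      ENNReal.ofReal_eq_coe_nnreal pi_pos.le]
  refine ⟨K * ((δ / 8) ^ 2 * π), K' * π, by positivity, by positivity, fun s hs x hx => ?_⟩
  have hN := norm_nonneg x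
  have hq := rhoD_nonneg κ x
  have hT : 0 < ‖x‖ + s := by linarith
  have hsq : (s * (‖x‖ + s) ^ (lam - 1) * (rhoD κ x + s)) ^ 2 =
      s ^ 2 * ((‖x‖ + s) ^ (2 * lam - 2) * (rhoD κ x + s) ^ 2) := by
    have : (‖x‖ + s) ^ (2 * lam - 2) = ((‖x‖ + s) ^ (lam - 1)) ^ 2 := by
      rw [← rpow_mul_natCast hT.le]; congr 1; push_cast; ring
    rw [this]; ring
  rw [hsq]
  set M := (‖x‖ + s) ^ (2 * lam - 2) * (rhoD κ x + s) ^ 2 with hM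
  have hM0 : 0 ≤ M := by positivity
  have hupper : wMeas κ 2 (2 * lam) (ballD κ x s) ≤ ENNReal.ofReal (K' * M * (s ^ 2 * π)) := by
    rw [← hball x _ _ (by positivity) hs.le, wMeas]
    calc _ ≤ ∫⁻ _ in ballD κ x s, ENNReal.ofReal (K' * M) :=
          setLIntegral_mono measurable_const fun y hy =>
            ENNReal.ofReal_le_ofReal (wgt_le hκ hlam hs hy)
      _ = ENNReal.ofReal (K' * M) * volume (ballD κ x s) := setLIntegral_const _ _
      _ ≤ _ := by gcongr; exact fun y hy => hy.2
  have hfin : wMeas κ 2 (2 * lam) (ballD κ x s) ≠ ⊤ :=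
    (hupper.trans_lt ENNReal.ofReal_lt_top).ne
  have hlower : ENNReal.ofReal (K * M * ((s * δ / 8) ^ 2 * π)) ≤
      wMeas κ 2 (2 * lam) (ballD κ x s) := by
    obtain ⟨z, hz, hsub⟩ := hcork x hx (s / 4) (by positivity)
    rw [← hball z _ _ (by positivity) (by positivity), wMeas]
    have hsδ : s * δ ≤ s := mul_le_of_le_one_right hs.le hδ1
    have hyx : ∀ y ∈ Metric.ball z (s * δ / 8), dist y x < s / 2 := fun y hy => by
      rw [Metric.mem_ball] at hy
      linarith [dist_triangle y z x]
    have hyD : ∀ y ∈ Metric.ball z (s * δ / 8), Metric.ball y (s * δ / 8) ⊆ Dset κ :=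
      fun y hy w hw => hsub (by
        rw [Metric.mem_ball] at hy hw ⊢
        linarith [dist_triangle w y z])
    have hyB : Metric.ball z (s * δ / 8) ⊆ ballD κ x s := fun y hy =>
      ⟨hyD y hy (Metric.mem_ball_self (by positivity)), by linarith [hyx y hy]⟩
    calc _ = ∫⁻ _ in Metric.ball z (s * δ / 8), ENNReal.ofReal (K * M) :=
          (setLIntegral_const _ _).symm
      _ ≤ ∫⁻ y in Metric.ball z (s * δ / 8), ENNReal.ofReal (wgt κ 2 (2 * lam) y) := by
          refine setLIntegral_mono' measurableSet_ball fun y hy =>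
            ENNReal.ofReal_le_ofReal (le_wgt hκ hs hc (hyB hy) ?_)
          have h1 := le_rhoD_of_ball_subset hκ (hyD y hy)
          have h2 := rhoD_le_rhoD_add_dist κ x y
          have h3 := hyx y hy
          rw [dist_comm] at h3
          rcases le_total (rhoD κ x) s with h | h
          · have : c * (rhoD κ x + s) ≤ c * (s + s) := by gcongr
            have : c * (s + s) = s * δ / 8 := by rw [hc_def]; ring
            linarith
          · have : c * (rhoD κ x + s) ≤ 1 / 16 * (rhoD κ x + s) := by
              gcongr; rw [hc_def]; linarith
            linarith
      _ ≤ _ := lintegral_mono_set hyB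
  constructor
  · have := (ENNReal.ofReal_le_iff_le_toReal hfin).mp hlower
    calc _ = K * M * ((s * δ / 8) ^ 2 * π) := by ring
      _ ≤ _ := this
  · calc _ ≤ K' * M * (s ^ 2 * π) := ENNReal.toReal_le_of_le_ofReal (by positivity) hupper
      _ = _ := by ring

theorem stmt6 (κ : ℝ) (hκ : 0 < κ) (hκ' : κ < 2 * π)
    (lam : ℝ) (hlam : 0 < lam) (hlam' : lam < π / κ) :
    ∃ c C : ℝ, 0 < c ∧ c ≤ C ∧ ∀ t : ℝ, 0 < t → ∀ x ∈ Dset κ, ∀ y ∈ Dset κ,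
      c * ((‖x‖ ^ (lam - 1) * rhoD κ x) * (‖y‖ ^ (lam - 1) * rhoD κ y) /
            Real.sqrt ((wMeas κ 2 (2 * lam) (ballD κ x (Real.sqrt t))).toReal *
              (wMeas κ 2 (2 * lam) (ballD κ y (Real.sqrt t))).toReal))
        ≤ (‖x‖ / (‖x‖ + Real.sqrt t)) ^ (lam - 1) * (‖y‖ / (‖y‖ + Real.sqrt t)) ^ (lam - 1) *
            (rhoD κ x / (rhoD κ x + Real.sqrt t)) * (rhoD κ y / (rhoD κ y + Real.sqrt t)) / t ∧
      (‖x‖ / (‖x‖ + Real.sqrt t)) ^ (lam - 1) * (‖y‖ / (‖y‖ + Real.sqrt t)) ^ (lam - 1) *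
          (rhoD κ x / (rhoD κ x + Real.sqrt t)) * (rhoD κ y / (rhoD κ y + Real.sqrt t)) / t
        ≤ C * ((‖x‖ ^ (lam - 1) * rhoD κ x) * (‖y‖ ^ (lam - 1) * rhoD κ y) /
            Real.sqrt ((wMeas κ 2 (2 * lam) (ballD κ x (Real.sqrt t))).toReal *
              (wMeas κ 2 (2 * lam) (ballD κ y (Real.sqrt t))).toReal)) := by
  obtain ⟨A, B, hA, hB, hV⟩ := wMeas_ballD_comparable hκ hκ' hlam
  refine ⟨A, max A B, hA, le_max_left _ _, fun t ht x hx y hy => ?_⟩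
  obtain ⟨s, hs, hst⟩ : ∃ s : ℝ, 0 < s ∧ √t = s := ⟨√t, Real.sqrt_pos.mpr ht, rfl⟩
  have hts : t = s * s := by rw [← hst, Real.mul_self_sqrt ht.le]
  rw [hst, hts]
  obtain ⟨hx1, hx2⟩ := hV s hs x hx
  obtain ⟨hy1, hy2⟩ := hV s hs y hy
  have hxn := norm_pos_of_mem_Dset hx
  have hyn := norm_pos_of_mem_Dset hy
  have hxq := rhoD_nonneg κ x
  have hyq := rhoD_nonneg κ y
  set Vx := (wMeas κ 2 (2 * lam) (ballD κ x s)).toReal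
  set Vy := (wMeas κ 2 (2 * lam) (ballD κ y s)).toReal
  have hx0 : 0 < s * (‖x‖ + s) ^ (lam - 1) * (rhoD κ x + s) := by positivity
  have hy0 : 0 < s * (‖y‖ + s) ^ (lam - 1) * (rhoD κ y + s) := by positivity
  have hmid : (‖x‖ / (‖x‖ + s)) ^ (lam - 1) * (‖y‖ / (‖y‖ + s)) ^ (lam - 1) *
      (rhoD κ x / (rhoD κ x + s)) * (rhoD κ y / (rhoD κ y + s)) / (s * s) =
      (‖x‖ ^ (lam - 1) * rhoD κ x) * (‖y‖ ^ (lam - 1) * rhoD κ y) /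
        ((s * (‖x‖ + s) ^ (lam - 1) * (rhoD κ x + s)) *
          (s * (‖y‖ + s) ^ (lam - 1) * (rhoD κ y + s))) := by
    rw [div_rpow hxn.le (by positivity), div_rpow hyn.le (by positivity)]
    field_simp
  rw [hmid]
  set mx := s * (‖x‖ + s) ^ (lam - 1) * (rhoD κ x + s)
  set my := s * (‖y‖ + s) ^ (lam - 1) * (rhoD κ y + s)
  have hW : 0 ≤ (‖x‖ ^ (lam - 1) * rhoD κ x) * (‖y‖ ^ (lam - 1) * rhoD κ y) := by positivity
  set W := (‖x‖ ^ (lam - 1) * rhoD κ x) * (‖y‖ ^ (lam - 1) * rhoD κ y)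
  have hVx : 0 < Vx := lt_of_lt_of_le (by positivity) hx1
  have hVy : 0 < Vy := lt_of_lt_of_le (by positivity) hy1
  have hS : 0 < √(Vx * Vy) := Real.sqrt_pos.mpr (by positivity)
  have hlow : A * (mx * my) ≤ √(Vx * Vy) := by
    refine Real.le_sqrt_of_sq_le ?_
    calc (A * (mx * my)) ^ 2 = (A * mx ^ 2) * (A * my ^ 2) := by ring
      _ ≤ Vx * Vy := by gcongr
  have hupp : √(Vx * Vy) ≤ B * (mx * my) := by
    refine Real.sqrt_le_iff.mpr ⟨by positivity, ?_⟩
    calc Vx * Vy ≤ (B * mx ^ 2) * (B * my ^ 2) := by gcongr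
      _ = _ := by ring
  constructor
  · rw [← mul_div_assoc, div_le_div_iff₀ hS (by positivity)]
    calc A * W * (mx * my) = W * (A * (mx * my)) := by ring
      _ ≤ _ := by gcongr
  · rw [← mul_div_assoc, div_le_div_iff₀ (by positivity) hS]
    calc W * √(Vx * Vy) ≤ W * (max A B * (mx * my)) := by
          gcongr
          exact hupp.trans (by gcongr; exact le_max_right _ _)
      _ = _ := by ring
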